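/- arXiv:2405.07785 — 2 statements merged into one kernel-verified Lean document; each statement's English description precedes it below -/
import Mathlib

section
/- For every μ > 0, if Z ~ Poisson(μ) with probability mass function p_μ(z) = e^{−μ}·μ^z/z!, then E[ −log p_μ(Z) ] ≤ μ·log(1 + 1/μ) + (1/2)·log( 6π(μ+1) ). In particular, the Shannon entropy of the Poisson(μ) distribution is at most 1 + (1/2)·log( 6π(μ+1) ). -/
open Filter Set

/-- The Poisson pmf with (real) mean `lam`. -/
noncomputable def poissonPMFr (lam : ℝ) (z : ℕ) : ℝ :=
  Real.exp (-lam) * lam ^ z / (z.factorial : ℝ)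

lemma pois_succ (μ : ℝ) (z : ℕ) :
    ((z + 1 : ℕ) : ℝ) * poissonPMFr μ (z + 1) = μ * poissonPMFr μ z := by
  unfold poissonPMFr
  have h : (z.factorial : ℝ) ≠ 0 := by positivity
  rw [Nat.factorial_succ]
  push_cast
  field_simp
  ring

lemma pois_hasSum0 (μ : ℝ) : HasSum (poissonPMFr μ) 1 := by
  have h := (NormedSpace.expSeries_div_hasSum_exp (𝔸 := ℝ) μ).mul_left (Real.exp (-μ))
  rw [← Real.exp_eq_exp_ℝ, ← Real.exp_add, neg_add_cancel, Real.exp_zero] at h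
  have e : poissonPMFr μ = fun i : ℕ => Real.exp (-μ) * (μ ^ i / (i.factorial : ℝ)) := by
    funext z
    simp only [poissonPMFr, mul_div_assoc]
  rw [e]
  exact h

lemma pois_hasSum1 (μ : ℝ) : HasSum (fun z : ℕ => (z : ℝ) * poissonPMFr μ z) μ := by
  rw [← hasSum_nat_add_iff' 1]
  have h := (pois_hasSum0 μ).mul_left μ
  simp only [pois_succ]
  simpa using h

lemma pois_hasSum2 (μ : ℝ) :
    HasSum (fun z : ℕ => (z : ℝ) * ((z : ℝ) * poissonPMFr μ z)) (μ ^ 2 + μ) := by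
  rw [← hasSum_nat_add_iff' 1]
  have h := ((pois_hasSum1 μ).add (pois_hasSum0 μ)).mul_left μ
  simp only [pois_succ]
  have e : (fun z : ℕ => ((z + 1 : ℕ) : ℝ) * (μ * poissonPMFr μ z))
      = fun z : ℕ => μ * ((z : ℝ) * poissonPMFr μ z + poissonPMFr μ z) := by
    funext z; push_cast; ring
  have e2 : μ ^ 2 + μ - ∑ i ∈ Finset.range 1, (i : ℝ) * ((i : ℝ) * poissonPMFr μ i)
      = μ * (μ + 1) := by
    simp; ring
  rw [e, e2]
  exact h

lemma log_tangent (a x : ℝ) (ha : 0 < a) (hx : 0 < x) :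
    Real.log x ≤ Real.log a + (x - a) / a := by
  have h := Real.log_le_sub_one_of_pos (div_pos hx ha)
  rw [Real.log_div hx.ne' ha.ne'] at h
  have : (x - a) / a = x / a - 1 := by field_simp
  linarith

lemma log_fact_le (z : ℕ) : Real.log (z.factorial : ℝ) ≤
    z * Real.log z - z + (1 / 2) * Real.log (6 * Real.pi * (z + 1)) := by
  have hpi := Real.pi_gt_three
  rcases Nat.eq_zero_or_pos z with rfl | hz
  · have : 0 ≤ Real.log (6 * Real.pi) := Real.log_nonneg (by linarith)
    simp; linarith
  · obtain ⟨n, rfl⟩ : ∃ n, z = n + 1 := ⟨z - 1, by omega⟩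
    have h := Stirling.log_stirlingSeq'_antitone (Nat.zero_le n)
    simp only [Function.comp, Nat.succ_eq_add_one, zero_add] at h
    rw [Stirling.log_stirlingSeq_formula, Stirling.stirlingSeq_one,
      Real.log_div (Real.exp_pos 1).ne' (Real.sqrt_pos.2 two_pos).ne', Real.log_exp 1,
      Real.log_sqrt (x := 2) (by norm_num)] at h
    have hx : (0 : ℝ) < ((n + 1 : ℕ) : ℝ) := by positivity
    set x : ℝ := ((n + 1 : ℕ) : ℝ)
    rw [Real.log_mul (by norm_num) hx.ne', Real.log_div hx.ne' (Real.exp_pos 1).ne', Real.log_exp] at h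
    rw [Real.log_mul (by positivity) (by positivity)]
    have h1 : Real.log x ≤ Real.log (x + 1) := Real.log_le_log hx (by linarith)
    have h2 : 2 ≤ Real.log (6 * Real.pi) := by
      rw [Real.le_log_iff_exp_le (by positivity)]
      have := Real.exp_one_lt_d9
      have e : Real.exp 2 = Real.exp 1 * Real.exp 1 := by rw [← Real.exp_add]; norm_num
      rw [e]
      nlinarith [Real.exp_pos 1]
    nlinarith

/-- For `Z ~ Poi(μ)`, `E[-log p_μ(Z)] ≤ μ log(1 + 1/μ) + (1/2) log (6π(μ+1))`;
in particular the Poisson entropy is at most `1 + (1/2) log (6π(μ+1))`. -/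
theorem poisson_neg_log_likelihood_bound (μ : ℝ) (hμ : 0 < μ) :
    (∑' z : ℕ, poissonPMFr μ z * (-(Real.log (poissonPMFr μ z)))) ≤
        μ * Real.log (1 + 1 / μ) + (1 / 2) * Real.log (6 * Real.pi * (μ + 1)) ∧
      (∑' z : ℕ, Real.negMulLog (poissonPMFr μ z)) ≤
        1 + (1 / 2) * Real.log (6 * Real.pi * (μ + 1)) := by
  have hpi := Real.pi_gt_three
  have hm : 0 < μ + 1 := by linarith
  have key : (∑' z : ℕ, poissonPMFr μ z * (-(Real.log (poissonPMFr μ z)))) ≤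
        μ * Real.log (1 + 1 / μ) + (1 / 2) * Real.log (6 * Real.pi * (μ + 1)) := by
    by_cases hs : Summable fun z : ℕ => poissonPMFr μ z * (-(Real.log (poissonPMFr μ z)))
    · set L := Real.log (μ + 1) with hL
      set C := Real.log (6 * Real.pi) with hC
      have hlog : Real.log (1 + 1 / μ) = L - Real.log μ := by
        rw [hL, ← Real.log_div hm.ne' hμ.ne']; congr 1; field_simp
      have hB := (((pois_hasSum0 μ).mul_left (μ + 1 / 2 * (C + L) - 1 / 2 * μ / (μ + 1))).add
        ((pois_hasSum1 μ).mul_left (-Real.log μ + L - 1 - 1 + 1 / 2 / (μ + 1)))).add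
        ((pois_hasSum2 μ).mul_left (1 / (μ + 1)))
      refine (hs.hasSum.tsum_eq ▸ hasSum_le ?_ hs.hasSum hB).trans (le_of_eq ?_)
      · intro z
        have hp : 0 < poissonPMFr μ z := by unfold poissonPMFr; positivity
        have hlp : Real.log (poissonPMFr μ z)
            = -μ + z * Real.log μ - Real.log (z.factorial : ℝ) := by
          unfold poissonPMFr
          rw [Real.log_div (by positivity) (by positivity),
            Real.log_mul (by positivity) (by positivity), Real.log_exp, Real.log_pow]
        have h1 := log_fact_le z
        rw [Real.log_mul (by positivity) (by positivity)] at h1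
        have h2 := log_tangent (μ + 1) (z + 1) hm (by positivity)
        have h3 : (z : ℝ) * Real.log z ≤ z * (L + (z - (μ + 1)) / (μ + 1)) := by
          rcases Nat.eq_zero_or_pos z with rfl | hz
          · simp
          · exact mul_le_mul_of_nonneg_left
              (log_tangent (μ + 1) z hm (by exact_mod_cast hz)) (by positivity)
        have h4 : -Real.log (poissonPMFr μ z) ≤ μ - z * Real.log μ +
            (z * (L + (z - (μ + 1)) / (μ + 1)) - z
              + 1 / 2 * (C + (L + (z + 1 - (μ + 1)) / (μ + 1)))) := by
          rw [hlp]; linarith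
        refine (mul_le_mul_of_nonneg_left h4 hp.le).trans (le_of_eq ?_)
        field_simp
        ring
      · rw [hlog, Real.log_mul (by positivity) (by positivity)]
        field_simp
        ring
    · rw [tsum_eq_zero_of_not_summable hs]
      have h1 : 0 ≤ Real.log (1 + 1 / μ) := Real.log_nonneg (by
        have : 0 < 1 / μ := by positivity
        linarith)
      have h2 : 0 ≤ Real.log (6 * Real.pi * (μ + 1)) := Real.log_nonneg (by nlinarith)
      positivity
  refine ⟨key, ?_⟩
  have e : (∑' z : ℕ, Real.negMulLog (poissonPMFr μ z))
      = ∑' z : ℕ, poissonPMFr μ z * (-(Real.log (poissonPMFr μ z))) := by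
    congr 1; ext z; simp [Real.negMulLog]
  rw [e]
  have h := Real.log_le_sub_one_of_pos (show 0 < 1 + 1 / μ by positivity)
  have h' : μ * Real.log (1 + 1 / μ) ≤ μ * (1 / μ) :=
    mul_le_mul_of_nonneg_left (by linarith) hμ.le
  rw [mul_one_div_cancel hμ.ne'] at h'
  linarith
end

section
/- Let U be a nonnegative real random variable with E[U²·log²U] < ∞, let 0 < s_min < 1 < s_max, set S := [s_min, s_max], assume P[U ∈ S] > 0, and let Ū := U|_S be the truncation of U to S. For a > 0 let V_a be such that V_a | U = u ~ Poisson(a·u), and let V̄_a satisfy V̄_a | Ū = u ~ Poisson(a·u). Then for every γ > 0: I(U;V_γ) ≤ I(Ū;V̄_γ) + γ·s_max·P[U < s_min] + γ·E[ U·log U · 1{U > s_max} ] + γ·E[ U·log(1/s_min) · 1{U > s_max} ]. -/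
open Filter Set MeasureTheory ProbabilityTheory

/-- Output marginal `P_V(z) = ∫ poi(a u, z) dμ(u)` of the Poisson channel
`V | U = u ~ Poi(a u)` with input law `μ` on `ℝ`. -/
noncomputable def poissonMarg (μ : Measure ℝ) (a : ℝ) (z : ℕ) : ℝ :=
  ∫ u, poissonPMFr (a * u) z ∂μ

/-- Mutual information (in nats) `I(U; V_a)` of the Poisson channel
`V_a | U = u ~ Poi(a u)` with input law `μ`, written as the average conditional
relative entropy `E_U[ D(P_{V|U} ‖ P_V) ]`, which equals the KL divergence
between the joint law and the product of the marginals. -/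
noncomputable def poissonMI (μ : Measure ℝ) (a : ℝ) : ℝ :=
  ∫ u, (∑' z : ℕ, poissonPMFr (a * u) z *
      Real.log (poissonPMFr (a * u) z / poissonMarg μ a z)) ∂μ

lemma pmfr_nonneg {l : ℝ} (hl : 0 ≤ l) (z : ℕ) : 0 ≤ poissonPMFr l z := by
  unfold poissonPMFr; positivity

lemma pmfr_hasSum (l : ℝ) : HasSum (poissonPMFr l) 1 := by
  have h := (NormedSpace.expSeries_div_hasSum_exp (l : ℝ)).mul_left (Real.exp (-l))
  rw [← Real.exp_eq_exp_ℝ, ← Real.exp_add, neg_add_cancel, Real.exp_zero] at h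
  refine h.congr_fun ?_
  intro z
  simp [poissonPMFr, mul_div_assoc]

lemma pmfr_le_one {l : ℝ} (hl : 0 ≤ l) (z : ℕ) : poissonPMFr l z ≤ 1 :=
  le_hasSum (pmfr_hasSum l) z (fun i _ => pmfr_nonneg hl i)

lemma pmfr_mean (l : ℝ) : HasSum (fun z : ℕ => poissonPMFr l z * z) l := by
  rw [← hasSum_nat_add_iff' 1]
  have h := (pmfr_hasSum l).mul_left l
  rw [mul_one] at h
  simp only [Finset.range_one, Finset.sum_singleton, Nat.cast_zero, mul_zero, sub_zero]
  refine h.congr_fun ?_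
  intro z
  simp only [poissonPMFr, Nat.factorial_succ]
  have : (z.factorial : ℝ) ≠ 0 := by positivity
  have : ((z : ℝ) + 1) ≠ 0 := by positivity
  push_cast
  field_simp
  ring

lemma pmfr_cont (a : ℝ) (z : ℕ) : Continuous (fun u => poissonPMFr (a * u) z) := by
  unfold poissonPMFr; fun_prop

lemma mul_log_lower {p r : ℝ} (hp : 0 ≤ p) (hr : 0 < r) : p - r ≤ p * Real.log (p / r) := by
  rcases hp.eq_or_lt with rfl | hp
  · simpa using hr.le
  · have h := Real.log_le_sub_one_of_pos (div_pos hr hp)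
    have h2 : Real.log (p / r) = - Real.log (r / p) := by
      rw [← Real.log_inv, inv_div]
    have h3 := mul_le_mul_of_nonneg_left h hp.le
    have h4 : p * (r / p - 1) = r - p := by field_simp
    rw [h2]; linarith

lemma mul_log_upper {γ smin smax u q : ℝ} (hγ : 0 < γ) (h0 : 0 < smin) (hu : 0 ≤ u) (z : ℕ)
    (hq : Real.exp (-(γ * smax)) * (γ * smin) ^ z / (z.factorial : ℝ) ≤ q) :
    poissonPMFr (γ * u) z * Real.log (poissonPMFr (γ * u) z / q) ≤
      poissonPMFr (γ * u) z * (γ * smax - γ * u) +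
        poissonPMFr (γ * u) z * z * Real.log (u / smin) := by
  have hp := pmfr_nonneg (mul_nonneg hγ.le hu) z
  rcases hp.eq_or_lt with hp0 | hp0
  · rw [← hp0]; simp
  have hL : 0 < Real.exp (-(γ * smax)) * (γ * smin) ^ z / (z.factorial : ℝ) := by positivity
  have hq0 := hL.trans_le hq
  rw [mul_assoc, ← mul_add]
  refine mul_le_mul_of_nonneg_left ?_ hp
  have hpow : (u / smin) ^ z ≠ 0 := by
    intro h
    apply hp0.ne'
    have : u ^ z = 0 := by
      rw [div_pow] at h
      have h3 : smin ^ z ≠ 0 := by positivity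
      simpa [h0.ne'] using h
    simp [poissonPMFr, mul_pow, this]
  calc Real.log (poissonPMFr (γ * u) z / q)
      ≤ Real.log (poissonPMFr (γ * u) z /
          (Real.exp (-(γ * smax)) * (γ * smin) ^ z / (z.factorial : ℝ))) := by
        apply Real.log_le_log (div_pos hp0 hq0)
        exact div_le_div_of_nonneg_left hp hL hq
    _ = Real.log (Real.exp (γ * smax - γ * u) * (u / smin) ^ z) := by
        congr 1
        have : (z.factorial : ℝ) ≠ 0 := by positivity
        rw [sub_eq_add_neg, Real.exp_add, poissonPMFr, Real.exp_neg (γ * smax), mul_pow, mul_pow,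
          div_pow]
        field_simp
    _ = _ := by
        rw [Real.log_mul (Real.exp_ne_zero _) hpow, Real.log_exp, Real.log_pow]

section
variable {ν : Measure ℝ} [IsFiniteMeasure ν] {γ : ℝ}

lemma pmfr_integrable (hν : ∀ᵐ u ∂ν, 0 ≤ u) (hγ : 0 < γ) (z : ℕ) :
    Integrable (fun u => poissonPMFr (γ * u) z) ν := by
  refine Integrable.of_bound (C := 1) (pmfr_cont γ z).aestronglyMeasurable ?_
  filter_upwards [hν] with u hu
  rw [Real.norm_of_nonneg (pmfr_nonneg (by positivity) z)]
  exact pmfr_le_one (by positivity) z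

lemma marg_nonneg (hν : ∀ᵐ u ∂ν, 0 ≤ u) (hγ : 0 < γ) (z : ℕ) : 0 ≤ poissonMarg ν γ z := by
  refine integral_nonneg_of_ae ?_
  filter_upwards [hν] with u hu
  exact pmfr_nonneg (by positivity) z

lemma marg_mix (hν : ∀ᵐ u ∂ν, 0 ≤ u) (hγ : 0 < γ) (w : ℕ → ℝ) (hw : ∀ z, 0 ≤ w z)
    (hs : Summable (fun z => poissonMarg ν γ z * w z)) :
    HasSum (fun z => poissonMarg ν γ z * w z)
      (∫ u, ∑' z, poissonPMFr (γ * u) z * w z ∂ν) := by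
  have h := hasSum_integral_of_summable_integral_norm (μ := ν)
    (F := fun z u => poissonPMFr (γ * u) z * w z)
    (fun z => (pmfr_integrable hν hγ z).mul_const _) ?_
  · simpa only [integral_mul_const, poissonMarg] using h
  · refine hs.congr ?_
    intro z
    rw [poissonMarg, ← integral_mul_const]
    apply integral_congr_ae
    filter_upwards [hν] with u hu
    rw [Real.norm_of_nonneg (mul_nonneg (pmfr_nonneg (by positivity) z) (hw z))]

lemma marg_hasSum [IsProbabilityMeasure ν] (hν : ∀ᵐ u ∂ν, 0 ≤ u) (hγ : 0 < γ) :
    HasSum (poissonMarg ν γ) 1 := by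
  have hs : Summable (poissonMarg ν γ) := by
    refine summable_of_sum_le (c := 1) (marg_nonneg hν hγ) ?_
    intro s
    simp only [poissonMarg]
    rw [← integral_finsetSum _ (fun z _ => pmfr_integrable hν hγ z)]
    calc _ ≤ ∫ u, (1 : ℝ) ∂ν := by
          refine integral_mono_ae (integrable_finsetSum _ (fun z _ => pmfr_integrable hν hγ z))
            (integrable_const _) ?_
          filter_upwards [hν] with u hu
          exact sum_le_hasSum s (fun i _ => pmfr_nonneg (by positivity) i) (pmfr_hasSum _)
      _ = 1 := by simp
  have h := marg_mix hν hγ (fun _ => 1) (fun _ => zero_le_one) (by simpa using hs)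
  simpa [(pmfr_hasSum _).tsum_eq] using h

end

/-- Lemma 7 of the paper: the loss in Poisson-channel mutual information due to
truncation of the input to `S = [s_min, s_max]` is controlled by three terms. -/
theorem truncation_MI_loss (μ : Measure ℝ) [IsProbabilityMeasure μ]
    (hU0 : μ {u | u < 0} = 0)
    (hmom : Integrable (fun u => u ^ 2 * (Real.log u) ^ 2) μ)
    (smin smax : ℝ) (h0 : 0 < smin) (h1 : smin < 1) (h2 : 1 < smax)
    (hS : 0 < μ (Set.Icc smin smax))
    (γ : ℝ) (hγ : 0 < γ) :
    poissonMI μ γ ≤ poissonMI (μ[|Set.Icc smin smax]) γ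
      + γ * smax * (μ {u | u < smin}).toReal
      + γ * ∫ u in {u | smax < u}, u * Real.log u ∂μ
      + γ * ∫ u in {u | smax < u}, u * Real.log (1 / smin) ∂μ := by
  set S := Set.Icc smin smax with hSdef
  have hSm : MeasurableSet S := measurableSet_Icc
  have hpos : ∀ᵐ u ∂μ, 0 ≤ u := by
    rw [ae_iff]; simpa using hU0
  have hprob : IsProbabilityMeasure (μ[|S]) := cond_isProbabilityMeasure hS.ne'
  have hcondS : ∀ᵐ u ∂(μ[|S]), u ∈ S := by
    rw [ProbabilityTheory.cond]
    exact Measure.ae_smul_measure (ae_restrict_mem hSm) _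
  have hcpos : ∀ᵐ u ∂(μ[|S]), 0 ≤ u := by
    filter_upwards [hcondS] with u hu
    exact h0.le.trans hu.1
  set c : ℝ := (μ S).toReal with hc
  have hc0 : 0 < c := ENNReal.toReal_pos hS.ne' (measure_ne_top _ _)
  have hc1 : c ≤ 1 := by
    have := ENNReal.toReal_mono ENNReal.one_ne_top (prob_le_one (μ := μ) (s := S))
    simpa using this
  have hcint : ∀ f : ℝ → ℝ, ∫ u, f u ∂(μ[|S]) = c⁻¹ * ∫ u in S, f u ∂μ := by
    intro f
    rw [ProbabilityTheory.cond, integral_smul_measure, ENNReal.toReal_inv, smul_eq_mul]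
  set m := poissonMarg μ γ with hm
  set q := poissonMarg (μ[|S]) γ with hq
  have hqlow : ∀ z : ℕ, Real.exp (-(γ * smax)) * (γ * smin) ^ z / (z.factorial : ℝ) ≤ q z := by
    intro z
    calc _ = ∫ u, Real.exp (-(γ * smax)) * (γ * smin) ^ z / (z.factorial : ℝ) ∂(μ[|S]) := by simp
      _ ≤ q z := by
        refine integral_mono_ae (integrable_const _) (pmfr_integrable hcpos hγ z) ?_
        filter_upwards [hcondS] with u hu
        obtain ⟨hu1, hu2⟩ := hu
        unfold poissonPMFr
        gcongr
  have hq0 : ∀ z, 0 < q z := fun z => lt_of_lt_of_le (by positivity) (hqlow z)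
  have hcq : ∀ z, c * q z ≤ m z := by
    intro z
    have : c * q z = ∫ u in S, poissonPMFr (γ * u) z ∂μ := by
      rw [hq, poissonMarg, hcint, mul_inv_cancel_left₀ hc0.ne']
    rw [this]
    refine setIntegral_le_integral (pmfr_integrable hpos hγ z) ?_
    filter_upwards [hpos] with u hu
    exact pmfr_nonneg (by positivity) z
  have hm0 : ∀ z, 0 < m z := fun z => lt_of_lt_of_le (mul_pos hc0 (hq0 z)) (hcq z)
  have hmsum : HasSum m 1 := marg_hasSum hpos hγ
  have hqsum : HasSum q 1 := marg_hasSum hcpos hγ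
  -- the auxiliary function H
  set w : ℕ → ℝ := fun z => q z / m z with hw
  have hw0 : ∀ z, 0 ≤ w z := fun z => (div_pos (hq0 z) (hm0 z)).le
  have hw1 : ∀ z, w z ≤ c⁻¹ := by
    intro z
    rw [hw, div_le_iff₀ (hm0 z), ← div_eq_inv_mul, le_div_iff₀ hc0, mul_comm]
    exact hcq z
  have hmw : (fun z => m z * w z) = q := by
    funext z
    exact mul_div_cancel₀ _ (hm0 z).ne'
  set H : ℝ → ℝ := fun u => ∑' z, poissonPMFr (γ * u) z * w z with hH
  have hHint : ∫ u, H u ∂μ = 1 := by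
    have h := marg_mix hpos hγ w hw0 (by rw [← hm, hmw]; exact hqsum.summable)
    rw [← hm, hmw] at h
    exact h.unique hqsum
  have hHI : Integrable H μ := integrable_of_integral_eq_one hHint
  have hHs : ∀ u, 0 ≤ u → HasSum (fun z => poissonPMFr (γ * u) z * w z) (H u) := by
    intro u hu
    apply Summable.hasSum
    refine Summable.of_nonneg_of_le
      (fun z => mul_nonneg (pmfr_nonneg (by positivity) z) (hw0 z))
      (fun z => mul_le_mul_of_nonneg_left (hw1 z) (pmfr_nonneg (by positivity) z))
      ((pmfr_hasSum _).summable.mul_right _)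
  -- G
  set G : ℝ → ℝ := fun u => ∑' z : ℕ, poissonPMFr (γ * u) z *
      Real.log (poissonPMFr (γ * u) z / q z) with hG
  set F : ℝ → ℝ := fun u => ∑' z : ℕ, poissonPMFr (γ * u) z *
      Real.log (poissonPMFr (γ * u) z / m z) with hF
  have hUp : ∀ u, HasSum (fun z : ℕ => poissonPMFr (γ * u) z * (γ * smax - γ * u) +
        poissonPMFr (γ * u) z * z * Real.log (u / smin))
        (1 * (γ * smax - γ * u) + γ * u * Real.log (u / smin)) := fun u =>
    ((pmfr_hasSum _).mul_right _).add ((pmfr_mean _).mul_right _)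
  have hsand : ∀ a b f : ℕ → ℝ, Summable a → Summable b → (∀ z, a z ≤ f z) →
      (∀ z, f z ≤ b z) → Summable f := by
    intro a b f ha hb h1 h2
    have h := Summable.of_nonneg_of_le (f := fun z => b z - a z) (g := fun z => f z - a z)
      (fun z => sub_nonneg.2 (h1 z)) (fun z => sub_le_sub_right (h2 z) _) (hb.sub ha)
    simpa using h.add ha
  have hGs : ∀ u, 0 ≤ u → HasSum (fun z : ℕ => poissonPMFr (γ * u) z *
      Real.log (poissonPMFr (γ * u) z / q z)) (G u) := by
    intro u hu
    apply Summable.hasSum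
    exact hsand _ _ _ ((pmfr_hasSum (γ * u)).sub hqsum).summable (hUp u).summable
      (fun z => mul_log_lower (pmfr_nonneg (by positivity) z) (hq0 z))
      (fun z => mul_log_upper hγ h0 hu z (hqlow z))
  have hG0 : ∀ u, 0 ≤ u → 0 ≤ G u := by
    intro u hu
    have := hasSum_le (fun z => mul_log_lower (pmfr_nonneg (by positivity) z) (hq0 z))
      ((pmfr_hasSum (γ * u)).sub hqsum) (hGs u hu)
    simpa using this
  have hGup : ∀ u, 0 ≤ u → G u ≤ γ * smax - γ * u + γ * u * Real.log (u / smin) := by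
    intro u hu
    have := hasSum_le (fun z => mul_log_upper hγ h0 hu z (hqlow z)) (hGs u hu) (hUp u)
    simpa using this
  have hFG : ∀ u, 0 ≤ u → F u ≤ G u - 1 + H u := by
    intro u hu
    have hb := ((hGs u hu).sub (pmfr_hasSum (γ * u))).add (hHs u hu)
    have hterm : ∀ z, poissonPMFr (γ * u) z * Real.log (poissonPMFr (γ * u) z / m z) ≤
        poissonPMFr (γ * u) z * Real.log (poissonPMFr (γ * u) z / q z) - poissonPMFr (γ * u) z
          + poissonPMFr (γ * u) z * w z := by
      intro z
      have hp := pmfr_nonneg (l := γ * u) (by positivity) z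
      rcases hp.eq_or_lt with hp0 | hp0
      · rw [← hp0]; simp
      have h := Real.log_le_sub_one_of_pos (div_pos (hq0 z) (hm0 z))
      have h3 := mul_le_mul_of_nonneg_left h hp
      rw [Real.log_div (hq0 z).ne' (hm0 z).ne'] at h3
      rw [Real.log_div hp0.ne' (hm0 z).ne', Real.log_div hp0.ne' (hq0 z).ne']
      simp only [hw]
      linarith
    have hs := hsand _ _ _ ((pmfr_hasSum (γ * u)).sub hmsum).summable hb.summable
      (fun z => mul_log_lower (pmfr_nonneg (by positivity) z) (hm0 z)) hterm
    exact hasSum_le hterm hs.hasSum hb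
  -- integrability of the terms
  have hGmeas : AEStronglyMeasurable G (μ.restrict S) := by
    refine aestronglyMeasurable_of_tendsto_ae (u := atTop) (f := fun n u =>
      ∑ z ∈ Finset.range n, poissonPMFr (γ * u) z *
        Real.log (poissonPMFr (γ * u) z / q z)) ?_ ?_
    · intro n
      apply Measurable.aestronglyMeasurable
      refine Finset.measurable_fun_sum _ (fun z _ => ?_)
      exact (pmfr_cont γ z).measurable.mul
        (Real.measurable_log.comp ((pmfr_cont γ z).measurable.div_const _))
    · filter_upwards [ae_restrict_mem hSm] with u hu
      exact (hGs u (h0.le.trans hu.1)).tendsto_sum_nat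
  have hGI : IntegrableOn G S μ := by
    refine Integrable.of_bound (C := γ * smax + γ * smax * Real.log (smax / smin)) hGmeas ?_
    filter_upwards [ae_restrict_mem hSm] with u hu
    have hu0 := h0.trans_le hu.1
    rw [Real.norm_of_nonneg (hG0 u hu0.le)]
    have hl0 : 0 ≤ Real.log (u / smin) := Real.log_nonneg ((one_le_div h0).2 hu.1)
    have hl : Real.log (u / smin) ≤ Real.log (smax / smin) :=
      Real.log_le_log (by positivity) (by gcongr; exact hu.2)
    have : γ * u * Real.log (u / smin) ≤ γ * smax * Real.log (smax / smin) := by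
      gcongr; exact hu.2
    have := hGup u hu0.le
    have : 0 < γ * u := by positivity
    linarith
  set B : Set ℝ := {u | smax < u} with hB
  set A : Set ℝ := {u | u < smin} with hA
  have hBm : MeasurableSet B := measurableSet_Ioi
  have hAm : MeasurableSet A := measurableSet_Iio
  have hulog : IntegrableOn (fun u => u * Real.log u) B μ := by
    have hint : IntegrableOn (fun u => 1 + u ^ 2 * (Real.log u) ^ 2) B μ :=
      ((integrable_const 1).add hmom).integrableOn
    refine Integrable.mono' hint (by fun_prop) ?_
    refine Eventually.of_forall fun u => ?_
    rw [Real.norm_eq_abs, abs_le]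
    constructor <;> nlinarith [sq_nonneg (u * Real.log u - 1), sq_nonneg (u * Real.log u + 1)]
  have hls : 0 < Real.log smax := Real.log_pos h2
  have huI : IntegrableOn (fun u => u) B μ := by
    refine Integrable.mono' (hulog.const_mul (Real.log smax)⁻¹) (by fun_prop) ?_
    filter_upwards [ae_restrict_mem hBm] with u hu
    have hu : smax < u := hu
    have hu0 : 0 < u := by linarith
    rw [Real.norm_of_nonneg hu0.le, ← div_eq_inv_mul, le_div_iff₀ hls]
    have := Real.log_le_log (by linarith) hu.le
    gcongr
  have hulog2 : IntegrableOn (fun u => u * Real.log (1 / smin)) B μ := huI.mul_const _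
  have hlsm : 0 < Real.log (1 / smin) := Real.log_pos ((one_lt_div h0).2 h1)
  have hMI : ∫ u in S, G u ∂μ ≤ poissonMI (μ[|S]) γ ∧ 0 ≤ poissonMI (μ[|S]) γ := by
    have e : poissonMI (μ[|S]) γ = c⁻¹ * ∫ u in S, G u ∂μ := hcint G
    have hn : 0 ≤ ∫ u in S, G u ∂μ :=
      setIntegral_nonneg hSm (fun u hu => hG0 u (h0.le.trans hu.1))
    rw [e]
    exact ⟨le_mul_of_one_le_left hn ((one_le_inv₀ hc0).2 hc1), by positivity⟩
  have hT2 : 0 ≤ ∫ u in B, u * Real.log u ∂μ := by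
    refine setIntegral_nonneg hBm (fun u hu => ?_)
    have hu : smax < u := hu
    exact mul_nonneg (by linarith) (Real.log_nonneg (by linarith))
  have hT3 : 0 ≤ ∫ u in B, u * Real.log (1 / smin) ∂μ := by
    refine setIntegral_nonneg hBm (fun u hu => ?_)
    have hu : smax < u := hu
    exact mul_nonneg (by linarith) hlsm.le
  have hT1 : 0 ≤ γ * smax * (μ A).toReal := by positivity
  have hMIF : poissonMI μ γ = ∫ u, F u ∂μ := rfl
  by_cases hFI : Integrable F μ
  swap
  · rw [hMIF, integral_undef hFI]
    have := hMI.2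
    positivity
  have i1 : Integrable (S.indicator G) μ := (integrable_indicator_iff hSm).2 hGI
  have i2 : Integrable (A.indicator (fun _ => γ * smax)) μ :=
    (integrable_const _).indicator hAm
  have i3 : Integrable (B.indicator (fun u => u * Real.log u)) μ :=
    (integrable_indicator_iff hBm).2 hulog
  have i4 : Integrable (B.indicator (fun u => u * Real.log (1 / smin))) μ :=
    (integrable_indicator_iff hBm).2 hulog2
  have hpt : ∀ᵐ u ∂μ, F u ≤ S.indicator G u + A.indicator (fun _ => γ * smax) u
      + γ * B.indicator (fun u => u * Real.log u) u
      + γ * B.indicator (fun u => u * Real.log (1 / smin)) u + (H u - 1) := by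
    filter_upwards [hpos] with u hu
    have hfg := hFG u hu
    suffices G u ≤ S.indicator G u + A.indicator (fun _ => γ * smax) u
      + γ * B.indicator (fun u => u * Real.log u) u
      + γ * B.indicator (fun u => u * Real.log (1 / smin)) u by linarith
    have hg := hGup u hu
    have hgu : 0 ≤ γ * u := by positivity
    rcases lt_or_ge u smin with hlt | hge
    · have e1 : u ∉ S := fun h => absurd h.1 (not_le.2 hlt)
      have e2 : u ∈ A := hlt
      have e3 : u ∉ B := fun h => by
        have h : smax < u := h
        linarith
      simp only [indicator_of_notMem e1, indicator_of_mem e2, indicator_of_notMem e3]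
      have : Real.log (u / smin) ≤ 0 :=
        Real.log_nonpos (by positivity) ((div_le_one h0).2 hlt.le)
      have := mul_nonpos_of_nonneg_of_nonpos hgu this
      linarith
    rcases le_or_gt u smax with hle | hgt
    · have e1 : u ∈ S := ⟨hge, hle⟩
      have e2 : u ∉ A := not_lt.2 hge
      have e3 : u ∉ B := not_lt.2 hle
      simp only [indicator_of_mem e1, indicator_of_notMem e2, indicator_of_notMem e3]
      linarith
    · have e1 : u ∉ S := fun h => absurd h.2 (not_le.2 hgt)
      have e2 : u ∉ A := not_lt.2 hge
      have e3 : u ∈ B := hgt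
      simp only [indicator_of_notMem e1, indicator_of_notMem e2, indicator_of_mem e3]
      have hu0 : 0 < u := by linarith
      have e : Real.log (u / smin) = Real.log u + Real.log (1 / smin) := by
        rw [← Real.log_mul hu0.ne' (by positivity)]
        congr 1; ring
      rw [e] at hg
      have : γ * smax ≤ γ * u := by gcongr
      linarith
  have i5 : Integrable (fun u => H u - 1) μ := hHI.sub (integrable_const _)
  have hle := integral_mono_ae hFI
    ((((i1.add i2).add (i3.const_mul γ)).add (i4.const_mul γ)).add i5) hpt
  have j1 := integral_add (((i1.add i2).add (i3.const_mul γ)).add (i4.const_mul γ)) i5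
  have j2 := integral_add ((i1.add i2).add (i3.const_mul γ)) (i4.const_mul γ)
  have j3 := integral_add (i1.add i2) (i3.const_mul γ)
  have j4 := integral_add i1 i2
  have j5 := integral_sub hHI (integrable_const (1 : ℝ))
  have j6 : ∫ u, A.indicator (fun _ => γ * smax) u ∂μ = γ * smax * (μ A).toReal := by
    rw [integral_indicator hAm, setIntegral_const, smul_eq_mul, mul_comm]; rfl
  simp only [Pi.add_apply] at hle j1 j2 j3 j4
  rw [j1, j2, j3, j4, j5, hHint, j6, integral_const_mul, integral_const_mul,
    integral_indicator hSm, integral_indicator hBm, integral_indicator hBm] at hle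
  simp only [integral_const, probReal_univ, smul_eq_mul, mul_one, sub_self, add_zero] at hle
  rw [hMIF]
  have := hMI.1
  linarith
end
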